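/- Asymptotics of the entropy of the angular-momentum distribution: for fixed 1/2 < p < 1 and n → ∞, the Shannon entropy of {q_J}_{J=0}^{n/2} satisfies H({q_J}) = (1/2) log n + O(1). -/

import Mathlib

/-- The angular-momentum distribution
`q_J = ((2J+1)/(2J₀))[B(n/2+J+1) − B(n/2−J)]`, with
`B(k) = C(n+1,k) p^k (1-p)^(n+1-k)` and `J₀ = (p-1/2)(n+1)`. -/
noncomputable def qSpec (p : ℝ) (n J : ℕ) : ℝ :=
  ((2*J+1 : ℝ)/(2*((p - 1/2)*(n+1)))) *
    ((Nat.choose (n+1) (n/2+J+1) : ℝ) * p^(n/2+J+1) * (1-p)^(n+1-(n/2+J+1))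
      - (Nat.choose (n+1) (n/2-J) : ℝ) * p^(n/2-J) * (1-p)^(n+1-(n/2-J)))

noncomputable def binB (p : ℝ) (N k : ℕ) : ℝ := (Nat.choose N k : ℝ) * p^k * (1-p)^(N-k)

lemma cb_bound (t : ℕ) : (Nat.centralBinom t)^2 * (2*t+1) ≤ 16^t := by
  induction t with
  | zero => simp
  | succ t ih =>
    have h := Nat.succ_mul_centralBinom_succ t
    have h2 : (t+1)^2 * ((Nat.centralBinom (t+1))^2 * (2*(t+1)+1)) ≤ (t+1)^2 * 16^(t+1) := by
      calc (t+1)^2 * ((Nat.centralBinom (t+1))^2 * (2*(t+1)+1))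
          = ((t+1) * Nat.centralBinom (t+1))^2 * (2*t+3) := by ring
        _ = (Nat.centralBinom t ^2 * (2*t+1)) * (4 * (2*t+1) * (2*t+3)) := by rw [h]; ring
        _ ≤ 16^t * (4 * (2*t+1) * (2*t+3)) := Nat.mul_le_mul_right _ ih
        _ ≤ 16^t * (16 * (t+1)^2) := by
            apply Nat.mul_le_mul_left; nlinarith
        _ = _ := by ring
    exact Nat.le_of_mul_le_mul_left h2 (by positivity)

lemma choose_bound (j i : ℕ) : (Nat.choose j i)^2 * (j+1) ≤ 4^j := by
  have h0 := Nat.choose_le_middle i j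
  have h1 : (Nat.choose j i)^2 * (j+1) ≤ (Nat.choose j (j/2))^2 * (j+1) := by gcongr
  refine h1.trans ?_
  rcases Nat.even_or_odd' j with ⟨t, rfl | rfl⟩
  · have := cb_bound t
    rw [Nat.centralBinom] at this
    rw [Nat.mul_div_cancel_left _ (by norm_num : 0 < 2), pow_mul]
    exact this
  · have h := cb_bound (t+1)
    have e : (2*t+1)/2 = t := by omega
    rw [e]
    have h3 : Nat.centralBinom (t+1) = 2 * Nat.choose (2*t+1) t := by
      rw [Nat.centralBinom, show 2*(t+1) = (2*t+1)+1 by ring, Nat.choose_succ_succ,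
        ← Nat.choose_symm_half t]
      simp; ring
    rw [h3] at h
    have h4 : (4:ℕ)^(2*t+1) = 4 * 16^t := by rw [pow_succ, pow_mul]; norm_num; ring
    rw [h4]
    have h5 : (16:ℕ)^(t+1) = 16 * 16^t := by ring
    rw [h5] at h
    have h6 : 4 * (Nat.choose (2*t+1) t ^ 2 * (2*t+1+1)) ≤
        (2 * Nat.choose (2*t+1) t)^2 * (2*(t+1)+1) := by
      rw [mul_pow]
      nlinarith [Nat.zero_le (Nat.choose (2*t+1) t ^ 2)]
    omega

lemma choose_real (j i : ℕ) (s : ℝ) (hs : 0 < s) :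
    (Nat.choose j i : ℝ) ≤ 2^j * ((s/(j+1) + 1/s)/2) := by
  have h : ((Nat.choose j i : ℝ))^2 * (j+1) ≤ 4^j := by exact_mod_cast choose_bound j i
  set a : ℝ := (Nat.choose j i : ℝ) / 2^j with ha
  have hc : (Nat.choose j i : ℝ) = 2^j * a := by rw [ha]; field_simp
  rw [hc]
  have h2 : a^2 ≤ 1/(j+1) := by
    rw [ha, div_pow, div_le_div_iff₀ (by positivity) (by positivity), ← pow_mul, mul_comm j 2, pow_mul]
    norm_num; exact h
  gcongr
  have h3 : s * a^2 ≤ s/(j+1) := by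
    calc _ ≤ s * (1/(j+1)) := by gcongr
      _ = _ := by ring
  have h4 : 0 ≤ (s*a - 1)^2 / s := by positivity
  have h5 : (s*a - 1)^2 / s = s*a^2 - 2*a + 1/s := by field_simp; ring
  linarith

lemma inv_mean (u v : ℝ) (hu : 0 < u) (hv : 0 ≤ v) (huv : u + v = 1) (N : ℕ) :
    ∑ j ∈ Finset.range (N+1), u^j * v^(N-j) * (Nat.choose N j : ℝ) / (j+1) ≤ 1/((N+1)*u) := by
  rw [le_div_iff₀ (by positivity), Finset.sum_mul]
  have h := add_pow u v (N+1)
  rw [huv, one_pow, Finset.sum_range_succ'] at h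
  have h2 : ∀ j ∈ Finset.range (N+1), u^j * v^(N-j) * (Nat.choose N j : ℝ) / (j+1) * ((N+1)*u)
      = u^(j+1) * v^(N+1-(j+1)) * (Nat.choose (N+1) (j+1) : ℝ) := by
    intro j _
    have : ((N:ℝ)+1) * Nat.choose N j = Nat.choose (N+1) (j+1) * (j+1) := by
      exact_mod_cast Nat.add_one_mul_choose_eq N j
    have e : N+1-(j+1) = N - j := by omega
    rw [e]
    field_simp
    linear_combination u^(j+1) * v^(N-j) * this
  rw [Finset.sum_congr rfl h2]
  have : 0 ≤ u^0 * v^(N+1-0) * (Nat.choose (N+1) 0 : ℝ) := by positivity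
  linarith

open Polynomial in
lemma binB_mix (p : ℝ) (N k : ℕ) :
    binB p N k = ∑ j ∈ Finset.range (N+1), (1-p)^j * (2*p-1)^(N-j) * (Nat.choose N j : ℝ) *
      ((1 + X : ℝ[X])^j * X^(N-j)).coeff k := by
  have h : (C p * X + C (1-p) : ℝ[X])^N = (C (1-p) * (1+X) + C (2*p-1) * X)^N := by
    congr 1
    simp only [C_sub, C_mul, C_1]
    rw [show (C (2:ℝ)) = 2 from rfl]; ring
  have h2 := congrArg (fun P => P.coeff k) h
  simp only [add_pow, finsetSum_coeff] at h2
  have hl : ∀ x, ((C p * X : ℝ[X])^x * (C (1-p))^(N-x) * (Nat.choose N x : ℝ[X])).coeff k =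
      if k = x then binB p N k else 0 := by
    intro x
    have : ((C p * X : ℝ[X])^x * (C (1-p))^(N-x) * (Nat.choose N x : ℝ[X])) =
      C (binB p N x) * X^x := by
      unfold binB
      simp only [C_mul, C_pow, mul_pow]
      rw [show (C (Nat.choose N x : ℝ)) = (Nat.choose N x : ℝ[X]) from by simp]; ring
    rw [this, coeff_C_mul, coeff_X_pow]
    split_ifs with h <;> simp [h]
  simp only [hl] at h2
  rw [Finset.sum_ite_eq] at h2
  have hz : (if k ∈ Finset.range (N+1) then binB p N k else 0) = binB p N k := by
    split_ifs with hk
    · rfl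
    · simp at hk; simp [binB, Nat.choose_eq_zero_of_lt (show N < k by omega)]
  rw [hz] at h2
  rw [h2]
  refine Finset.sum_congr rfl fun j _ => ?_
  rw [← coeff_C_mul]
  congr 1
  simp only [C_mul, C_pow, mul_pow]
  rw [show (C (Nat.choose N j : ℝ)) = (Nat.choose N j : ℝ[X]) from by simp]; ring

lemma binB_nonneg (p : ℝ) (hp : 1/2 < p) (hp1 : p < 1) (N k : ℕ) : 0 ≤ binB p N k := by
  have : 0 < 1 - p := by linarith
  unfold binB; positivity

open Polynomial in
lemma binB_le (p : ℝ) (hp : 1/2 < p) (hp1 : p < 1) (N k : ℕ) (s : ℝ) (hs : 0 < s) :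
    binB p N k ≤ (s/((N+1)*(2*(1-p))) + 1/s)/2 := by
  have hr : 0 < 1 - p := by linarith
  have hv : 0 < 2*p-1 := by linarith
  rw [binB_mix]
  have hc : ∀ j : ℕ, ((1 + X : ℝ[X])^j * X^(N-j)).coeff k ≤ 2^j * ((s/(j+1) + 1/s)/2) := by
    intro j
    rw [coeff_mul_X_pow']
    split_ifs
    · rw [coeff_one_add_X_pow]; exact choose_real _ _ s hs
    · positivity
  calc _ ≤ ∑ j ∈ Finset.range (N+1), (1-p)^j * (2*p-1)^(N-j) * (Nat.choose N j : ℝ) *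
      (2^j * ((s/(j+1) + 1/s)/2)) := by
        refine Finset.sum_le_sum fun j _ => ?_
        exact mul_le_mul_of_nonneg_left (hc j) (by positivity)
    _ = s/2 * (∑ j ∈ Finset.range (N+1), (2*(1-p))^j * (2*p-1)^(N-j) * (Nat.choose N j : ℝ) / (j+1))
      + 1/s/2 * ∑ j ∈ Finset.range (N+1), (2*(1-p))^j * (2*p-1)^(N-j) * (Nat.choose N j : ℝ) := by
        rw [Finset.mul_sum, Finset.mul_sum, ← Finset.sum_add_distrib]
        refine Finset.sum_congr rfl fun j _ => ?_
        rw [mul_pow]; ring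
    _ ≤ s/2 * (1/((N+1)*(2*(1-p)))) + 1/s/2 * 1 := by
        gcongr
        · exact inv_mean _ _ (by positivity) hv.le (by ring) N
        · rw [← add_pow]; ring_nf; simp
    _ = _ := by ring

open Polynomial in
lemma bern_eval (p : ℝ) (N k : ℕ) : (bernsteinPolynomial ℝ N k).eval p = binB p N k := by
  simp [bernsteinPolynomial, binB]

lemma binB_sum (p : ℝ) (N : ℕ) : ∑ k ∈ Finset.range (N+1), binB p N k = 1 := by
  have := congrArg (Polynomial.eval p) (bernsteinPolynomial.sum ℝ N)
  simpa [Polynomial.eval_finsetSum, bern_eval] using this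

lemma binB_mean (p : ℝ) (N : ℕ) : ∑ k ∈ Finset.range (N+1), (k:ℝ) * binB p N k = N * p := by
  have := congrArg (Polynomial.eval p) (bernsteinPolynomial.sum_smul ℝ N)
  simpa [Polynomial.eval_finsetSum, bern_eval] using this

lemma binB_var (p : ℝ) (N : ℕ) :
    ∑ k ∈ Finset.range (N+1), ((k:ℝ) - N*p)^2 * binB p N k = N * p * (1-p) := by
  have := congrArg (Polynomial.eval p) (bernsteinPolynomial.variance ℝ N)
  simp [Polynomial.eval_finsetSum, bern_eval] at this
  rw [← this]
  refine Finset.sum_congr rfl fun j _ => ?_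
  ring

lemma atan_step (s x : ℝ) (hs : 1 ≤ s) :
    s/(s^2+x^2) ≤ 4 * (Real.arctan ((x+1)/s) - Real.arctan (x/s)) := by
  have hs0 : 0 < s := by linarith
  have hd : ∀ y : ℝ, HasDerivAt (fun y => Real.arctan (y/s)) (s/(s^2+y^2)) y := by
    intro y
    have := ((hasDerivAt_id y).div_const s).arctan
    convert this using 1
    simp only [id]
    field_simp
    simp
  obtain ⟨c, hc, h⟩ := exists_hasDerivAt_eq_slope (fun y => Real.arctan (y/s))
    (fun y => s/(s^2+y^2)) (show x < x+1 by linarith)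
    (fun y _ => (hd y).continuousAt.continuousWithinAt) (fun y _ => hd y)
  rw [show x+1-x = 1 by ring, div_one] at h
  rw [← h, ← mul_div_assoc, div_le_div_iff₀ (by positivity) (by positivity)]
  have : s^2 + c^2 ≤ 4*(s^2+x^2) := by
    obtain ⟨h1, h2⟩ := hc
    nlinarith [sq_nonneg (x-1), sq_nonneg (x+1), sq_nonneg (c - 2*x)]
  nlinarith

lemma cauchy_sum (s a : ℝ) (hs : 1 ≤ s) (M : ℕ) :
    ∑ J ∈ Finset.range M, s/(s^2+((J:ℝ)+a)^2) ≤ 4 * Real.pi := by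
  calc _ ≤ ∑ J ∈ Finset.range M, 4 * (Real.arctan ((((J+1:ℕ):ℝ)+a)/s) - Real.arctan (((J:ℝ)+a)/s)) := by
        refine Finset.sum_le_sum fun J _ => ?_
        have := atan_step s (J+a) hs
        rw [show (J:ℝ)+a+1 = ((J+1:ℕ):ℝ)+a by push_cast; ring] at this
        exact this
    _ = 4 * (Real.arctan (((M:ℝ)+a)/s) - Real.arctan ((((0:ℕ):ℝ)+a)/s)) := by
        rw [← Finset.mul_sum, Finset.sum_range_sub (fun J : ℕ => Real.arctan (((J:ℝ)+a)/s))]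
    _ ≤ _ := by
        have := Real.arctan_lt_pi_div_two (((M:ℝ)+a)/s)
        have := Real.neg_pi_div_two_lt_arctan ((((0:ℕ):ℝ)+a)/s)
        linarith

lemma q_eq (p : ℝ) (m J : ℕ) : qSpec p (2*m) J =
    ((2*J+1 : ℝ)/((2*p-1)*(2*m+1))) * (binB p (2*m+1) (m+1+J) - binB p (2*m+1) (m-J)) := by
  unfold qSpec binB
  rw [Nat.mul_div_cancel_left _ (by norm_num : 0 < 2), show m + J + 1 = m+1+J by ring]
  push_cast
  congr 2
  ring

lemma binB_anti (p : ℝ) (hp : 1/2 < p) (hp1 : p < 1) (m J : ℕ) (hJ : J ≤ m) :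
    binB p (2*m+1) (m-J) ≤ binB p (2*m+1) (m+1+J) := by
  have hr : 0 < 1 - p := by linarith
  unfold binB
  have e : 2*m+1 - (m+1+J) = m - J := by omega
  have e2 : 2*m+1 - (m-J) = (m-J) + (2*J+1) := by omega
  have e3 : m+1+J = (m-J) + (2*J+1) := by omega
  rw [← Nat.choose_symm (show m+1+J ≤ 2*m+1 by omega), e, e2, e3, mul_assoc, mul_assoc]
  refine mul_le_mul_of_nonneg_left ?_ (by positivity)
  rw [pow_add p (m-J) (2*J+1), pow_add (1-p) (m-J) (2*J+1)]
  have : (1-p)^(2*J+1) ≤ p^(2*J+1) := by gcongr; linarith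
  calc p^(m-J) * ((1-p)^(m-J) * (1-p)^(2*J+1)) ≤ p^(m-J) * ((1-p)^(m-J) * p^(2*J+1)) := by gcongr
    _ = _ := by ring

lemma q_nonneg (p : ℝ) (hp : 1/2 < p) (hp1 : p < 1) (m J : ℕ) (hJ : J ≤ m) :
    0 ≤ qSpec p (2*m) J := by
  rw [q_eq]
  have : 0 < 2*p-1 := by linarith
  exact mul_nonneg (by positivity) (sub_nonneg.2 (binB_anti p hp hp1 m J hJ))

lemma q_le (p : ℝ) (hp : 1/2 < p) (hp1 : p < 1) (m J : ℕ) (hJ : J ≤ m) :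
    qSpec p (2*m) J ≤ 1/(2*p-1) * binB p (2*m+1) (m+1+J) := by
  rw [q_eq]
  have h : 0 < 2*p-1 := by linarith
  have h1 := binB_nonneg p hp hp1 (2*m+1) (m-J)
  have h2 := binB_anti p hp hp1 m J hJ
  have hJ' : (J:ℝ) ≤ m := by exact_mod_cast hJ
  apply mul_le_mul
  · rw [div_le_div_iff₀ (by positivity) h]
    nlinarith
  · linarith
  · linarith
  · positivity

lemma q_sum (p : ℝ) (hp : 1/2 < p) (m : ℕ) :
    ∑ J ∈ Finset.range (m+1), qSpec p (2*m) J = 1 := by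
  have h : 0 < 2*p-1 := by linarith
  have h1 := binB_sum p (2*m+1)
  have h2 := binB_mean p (2*m+1)
  have h3 : ∑ k ∈ Finset.range ((m+1)+(m+1)), (2*(k:ℝ) - (2*m+1)) * binB p (2*m+1) k
      = (2*p-1)*(2*m+1) := by
    have : ∀ k ∈ Finset.range ((m+1)+(m+1)), (2*(k:ℝ) - (2*m+1)) * binB p (2*m+1) k =
      2 * ((k:ℝ) * binB p (2*m+1) k) - (2*m+1) * binB p (2*m+1) k := fun k _ => by ring
    rw [Finset.sum_congr rfl this, Finset.sum_sub_distrib, ← Finset.mul_sum, ← Finset.mul_sum,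
      show (m+1)+(m+1) = 2*m+1+1 by ring, h1, h2]
    push_cast; ring
  rw [Finset.sum_range_add, ← Finset.sum_range_reflect, ← Finset.sum_add_distrib] at h3
  have h4 : ∀ J ∈ Finset.range (m+1), qSpec p (2*m) J = ((2*p-1)*(2*m+1))⁻¹ *
     ((2*((m+1-1-J : ℕ):ℝ) - (2*m+1)) * binB p (2*m+1) (m+1-1-J) +
      (2*((m+1+J : ℕ):ℝ) - (2*m+1)) * binB p (2*m+1) (m+1+J)) := by
    intro J hJ
    have hJ' : J ≤ m := by simp at hJ; omega
    rw [q_eq, Nat.add_sub_cancel]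
    push_cast [Nat.cast_sub hJ']
    rw [div_eq_mul_inv]
    ring
  rw [Finset.sum_congr rfl h4, ← Finset.mul_sum, h3]
  have : (2*p-1)*(2*(m:ℝ)+1) ≠ 0 := by positivity
  exact inv_mul_cancel₀ this

lemma q_var (p : ℝ) (hp : 1/2 < p) (hp1 : p < 1) (m : ℕ) :
    ∑ J ∈ Finset.range (m+1), qSpec p (2*m) J * ((J:ℝ) + (m+1 - (2*m+1)*p))^2 ≤
      1/(2*p-1) * (2*m+1) := by
  have h : 0 < 2*p-1 := by linarith
  have hv := binB_var p (2*m+1)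
  rw [show 2*m+1+1 = (m+1)+(m+1) by ring, Finset.sum_range_add] at hv
  have hn : 0 ≤ ∑ k ∈ Finset.range (m+1), ((k:ℝ) - (2*m+1:ℕ)*p)^2 * binB p (2*m+1) k :=
    Finset.sum_nonneg fun k _ => mul_nonneg (sq_nonneg _) (binB_nonneg p hp hp1 _ _)
  calc _ ≤ ∑ J ∈ Finset.range (m+1), 1/(2*p-1) *
        ((((m+1+J:ℕ):ℝ) - (2*m+1:ℕ)*p)^2 * binB p (2*m+1) (m+1+J)) := by
        refine Finset.sum_le_sum fun J hJ => ?_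
        have hJ' : J ≤ m := by simp at hJ; omega
        have := mul_le_mul_of_nonneg_right (q_le p hp hp1 m J hJ')
          (sq_nonneg ((J:ℝ) + (m+1 - (2*m+1)*p)))
        refine this.trans (le_of_eq ?_)
        push_cast; ring
    _ ≤ 1/(2*p-1) * ((2*m+1:ℕ) * p * (1-p)) := by
        rw [← Finset.mul_sum]
        refine mul_le_mul_of_nonneg_left ?_ (by positivity)
        linarith
    _ ≤ _ := by
        refine mul_le_mul_of_nonneg_left ?_ (by positivity)
        push_cast
        have : p*(1-p) ≤ 1 := by nlinarith
        have h0 : (0:ℝ) ≤ 2*m+1 := by positivity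
        nlinarith

lemma gibbs (q g : ℝ) (hq : 0 ≤ q) (hg : 0 < g) :
    Real.negMulLog q ≤ q * (-Real.log g) + g - q := by
  rcases hq.eq_or_lt with rfl | hq
  · simp [hg.le]
  · have := Real.log_le_sub_one_of_pos (div_pos hg hq)
    rw [Real.log_div hg.ne' hq.ne'] at this
    have h2 := mul_le_mul_of_nonneg_left this hq.le
    have e : q * (g/q - 1) = g - q := by field_simp
    rw [e] at h2
    unfold Real.negMulLog
    linarith

theorem entropy_qJ_asymptotics (p : ℝ) (hp : 1/2 < p) (hp1 : p < 1) :
    ∃ C : ℝ, 0 < C ∧ ∃ N : ℕ, ∀ n : ℕ, N ≤ n → Even n →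
      |(∑ J ∈ Finset.range (n/2+1), Real.negMulLog (qSpec p n J))
          - (1/2) * Real.log n| ≤ C := by
  have h : 0 < 2*p-1 := by linarith
  have hr : 0 < 1-p := by linarith
  set K : ℝ := 1/(2*p-1) * ((1/(2*(1-p)) + 1)/2) with hK
  have hKpos : 0 < K := by positivity
  refine ⟨|Real.log K| + (2/(2*p-1) + 4*Real.pi), by positivity, 1, ?_⟩
  rintro n hn ⟨m, hm⟩
  obtain rfl : n = 2*m := by omega
  rw [Nat.mul_div_cancel_left _ (by norm_num : 0 < 2)]
  have hn1 : (1:ℝ) ≤ ((2*m:ℕ):ℝ) := by exact_mod_cast hn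
  set s : ℝ := Real.sqrt ((2*m:ℕ):ℝ) with hs
  have hs1 : 1 ≤ s := by rw [hs]; exact Real.one_le_sqrt.2 hn1
  have hs0 : 0 < s := by linarith
  have hss : s^2 = 2*(m:ℝ) := by rw [hs, Real.sq_sqrt (by linarith)]; push_cast; ring
  have hlog : Real.log ((2*m:ℕ):ℝ) = 2 * Real.log s := by
    rw [hs, Real.log_sqrt (by linarith)]; ring
  have hsum := q_sum p hp m
  have lower : Real.log s - Real.log K ≤
      ∑ J ∈ Finset.range (m+1), Real.negMulLog (qSpec p (2*m) J) := by
    calc _ = ∑ J ∈ Finset.range (m+1), qSpec p (2*m) J * (Real.log s - Real.log K) := by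
          rw [← Finset.sum_mul, hsum, one_mul]
      _ ≤ _ := by
          refine Finset.sum_le_sum fun J hJ => ?_
          have hJ' : J ≤ m := by simp at hJ; omega
          rcases (q_nonneg p hp hp1 m J hJ').eq_or_lt with h0 | h0
          · simp [← h0]
          · have hle : qSpec p (2*m) J ≤ K/s := by
              refine (q_le p hp hp1 m J hJ').trans ?_
              have := binB_le p hp hp1 (2*m+1) (m+1+J) s hs0
              rw [hK, mul_div_assoc]
              refine mul_le_mul_of_nonneg_left (this.trans ?_) (by positivity)
              have : s/((((2*m+1:ℕ):ℝ)+1)*(2*(1-p))) ≤ 1/(2*(1-p))/s := by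
                rw [div_div, div_le_div_iff₀ (by positivity) (by positivity)]
                push_cast
                nlinarith
              calc _ ≤ (1/(2*(1-p))/s + 1/s)/2 := by gcongr
                _ = _ := by ring
            have hl := Real.log_le_log h0 hle
            rw [Real.log_div hKpos.ne' hs0.ne'] at hl
            unfold Real.negMulLog
            have := mul_le_mul_of_nonneg_left hl h0.le
            linarith
  have upper : ∑ J ∈ Finset.range (m+1), Real.negMulLog (qSpec p (2*m) J) ≤
      Real.log s + (2/(2*p-1) + 4*Real.pi) := by
    set a : ℝ := (m+1 - (2*m+1)*p) with ha
    have step : ∀ J ∈ Finset.range (m+1), Real.negMulLog (qSpec p (2*m) J) ≤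
        qSpec p (2*m) J * Real.log s + (1/s^2) * (qSpec p (2*m) J * ((J:ℝ)+a)^2) +
          s/(s^2+((J:ℝ)+a)^2) := by
      intro J hJ
      have hJ' : J ≤ m := by simp at hJ; omega
      have hq := q_nonneg p hp hp1 m J hJ'
      have hg := gibbs (qSpec p (2*m) J) (s/(s^2+((J:ℝ)+a)^2)) hq (by positivity)
      have hl : -Real.log (s/(s^2+((J:ℝ)+a)^2)) ≤ Real.log s + ((J:ℝ)+a)^2/s^2 := by
        have e : s^2+((J:ℝ)+a)^2 = s^2 * (1 + ((J:ℝ)+a)^2/s^2) := by field_simp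
        rw [e, Real.log_div hs0.ne' (by positivity), Real.log_mul (by positivity) (by positivity),
          Real.log_pow]
        have := Real.log_le_sub_one_of_pos (show 0 < 1 + ((J:ℝ)+a)^2/s^2 by positivity)
        push_cast
        linarith
      have := mul_le_mul_of_nonneg_left hl hq
      have e : qSpec p (2*m) J * (Real.log s + ((J:ℝ)+a)^2/s^2) =
        qSpec p (2*m) J * Real.log s + (1/s^2) * (qSpec p (2*m) J * ((J:ℝ)+a)^2) := by ring
      linarith
    refine (Finset.sum_le_sum step).trans ?_
    rw [Finset.sum_add_distrib, Finset.sum_add_distrib, ← Finset.sum_mul, ← Finset.mul_sum, hsum]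
    have hc := cauchy_sum s a hs1 (m+1)
    have hv := q_var p hp hp1 m
    rw [← ha] at hv
    have hv2 : (1/s^2) * ∑ J ∈ Finset.range (m+1), qSpec p (2*m) J * ((J:ℝ)+a)^2 ≤ 2/(2*p-1) := by
      calc _ ≤ (1/s^2) * (1/(2*p-1) * (2*m+1)) := by gcongr
        _ ≤ _ := by
          rw [← hss]
          have : (1/s^2) * (1/(2*p-1) * (s^2+1)) = (1 + 1/s^2)/(2*p-1) := by field_simp
          rw [this]
          gcongr
          have : 1/s^2 ≤ 1 := by
            rw [div_le_one (by positivity)]; nlinarith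
          linarith
    linarith
  rw [hlog, abs_le]
  have := le_abs_self (Real.log K)
  have := abs_nonneg (Real.log K)
  have : 0 < 2/(2*p-1) + 4*Real.pi := by positivity
  constructor <;> linarith
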